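/- Let K be a field with a field automorphism τ, and let ϑ ∈ K satisfy τ^k(ϑ) ≠ ϑ for all k ≥ 1. For n ≥ 2 and elements z_1, …, z_n ∈ K, the n×n determinant det(E_{i-1}(z_j))_{1≤i,j≤n} vanishes if and only if z_1, …, z_n are linearly dependent over the fixed field K^τ. -/

import Mathlib

/-- The operators `E_k` of the generalized Carlitz module attached to a
difference field `(K, τ)` and an element `ϑ`. -/
noncomputable def carlitzE {K : Type*} [Field K] (τ : RingAut K) (ϑ : K) : ℕ → K → K
  | 0, z => z
  | k + 1, z =>
      (τ (carlitzE τ ϑ k z) - carlitzE τ ϑ k z) / ((τ ^ (k + 1)) ϑ - ϑ)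

theorem carlitzE_tau {K : Type*} [Field K] (τ : RingAut K) (ϑ : K)
    (hϑ : ∀ k : ℕ, 1 ≤ k → (τ ^ k) ϑ ≠ ϑ) (k : ℕ) (z : K) :
    τ (carlitzE τ ϑ k z) =
      carlitzE τ ϑ k z + ((τ ^ (k + 1)) ϑ - ϑ) * carlitzE τ ϑ (k + 1) z := by
  have h : (τ ^ (k + 1)) ϑ - ϑ ≠ 0 := sub_ne_zero.mpr (hϑ _ (by omega))
  rw [show carlitzE τ ϑ (k + 1) z =
    (τ (carlitzE τ ϑ k z) - carlitzE τ ϑ k z) / ((τ ^ (k + 1)) ϑ - ϑ) from rfl,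
    mul_div_cancel₀ _ h]
  ring

theorem carlitzE_sum {K : Type*} [Field K] (τ : RingAut K) (ϑ : K) {n : ℕ}
    (z c : Fin n → K) (hc : ∀ i, τ (c i) = c i) (k : ℕ) :
    carlitzE τ ϑ k (∑ i, c i * z i) = ∑ i, c i * carlitzE τ ϑ k (z i) := by
  induction k with
  | zero => rfl
  | succ k ih =>
    simp only [carlitzE, ih, map_sum, map_mul, hc]
    rw [← Finset.sum_sub_distrib, Finset.sum_div]
    exact Finset.sum_congr rfl fun i _ => by ring

theorem carlitzE_zero {K : Type*} [Field K] (τ : RingAut K) (ϑ : K) (k : ℕ) :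
    carlitzE τ ϑ k 0 = 0 := by
  induction k with
  | zero => rfl
  | succ k ih => simp [carlitzE, ih]

theorem carlitzE_kill {K : Type*} [Field K] (τ : RingAut K) (ϑ : K)
    (hϑ : ∀ k : ℕ, 1 ≤ k → (τ ^ k) ϑ ≠ ϑ) (n : ℕ) (z d : Fin n → K)
    (h : ∀ i < n, ∑ j, d j * carlitzE τ ϑ i (z j) = 0) (m : ℕ) :
    ∀ i, i + m < n → ∑ j, d j * (τ ^ m) (carlitzE τ ϑ i (z j)) = 0 := by
  induction m with
  | zero => intro i hi; simpa using h i hi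
  | succ m ih =>
    intro i hi
    have h1 := ih i (by omega)
    have h2 := ih (i + 1) (by omega)
    have : ∀ j, d j * (τ ^ (m + 1)) (carlitzE τ ϑ i (z j)) =
        d j * (τ ^ m) (carlitzE τ ϑ i (z j)) + (τ ^ m) ((τ ^ (i + 1)) ϑ - ϑ) *
          (d j * (τ ^ m) (carlitzE τ ϑ (i + 1) (z j))) := by
      intro j
      rw [pow_succ τ m, RingAut.mul_apply, carlitzE_tau τ ϑ hϑ, map_add, map_mul]
      ring
    rw [Finset.sum_congr rfl fun j _ => this j, Finset.sum_add_distrib, ← Finset.mul_sum, h1, h2]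
    simp

theorem casorati_dep {K : Type*} [Field K] (τ : RingAut K) (n : ℕ) (z : Fin n → K) (m : ℕ) :
    ∀ (s : Finset (Fin n)) (d : Fin n → K), s.card = m → (∀ j, j ∉ s → d j = 0) → d ≠ 0 →
      (∀ i < m, ∑ j, d j * (τ ^ i) (z j) = 0) →
      ∃ c : Fin n → K, (∀ i, τ (c i) = c i) ∧ c ≠ 0 ∧ ∑ i, c i * z i = 0 := by
  induction m with
  | zero =>
    intro s d hs hd hd0
    rw [Finset.card_eq_zero] at hs
    subst hs
    exact absurd (funext fun j => hd j (by simp)) hd0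
  | succ m ih =>
    intro s d hs hd hd0 h
    obtain ⟨j0, hj0⟩ := Function.ne_iff.mp hd0
    have hj0 : d j0 ≠ 0 := hj0
    have hjs : j0 ∈ s := by by_contra hh; exact hj0 (hd _ hh)
    set e : Fin n → K := fun j => d j / d j0 with he
    have hek : ∀ i < m + 1, ∑ j, e j * (τ ^ i) (z j) = 0 := by
      intro i hi
      have : ∀ j, e j * (τ ^ i) (z j) = (d j0)⁻¹ * (d j * (τ ^ i) (z j)) := by
        intro j; simp only [he]; ring
      rw [Finset.sum_congr rfl fun j _ => this j, ← Finset.mul_sum, h i hi, mul_zero]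
    have he1 : e j0 = 1 := div_self hj0
    by_cases hfix : ∀ j, τ (e j) = e j
    · refine ⟨e, hfix, ?_, by simpa using hek 0 (by omega)⟩
      intro h0
      rw [h0] at he1
      simp at he1
    · push Not at hfix
      obtain ⟨j1, hj1⟩ := hfix
      refine ih (s.erase j0) (fun j => e j - τ.symm (e j)) ?_ ?_ ?_ ?_
      · rw [Finset.card_erase_of_mem hjs, hs]; rfl
      · intro j hj
        by_cases hjj : j = j0
        · subst hjj; simp [he1]
        · have : e j = 0 := by
            simp only [he]; rw [hd j (fun hh => hj (Finset.mem_erase.mpr ⟨hjj, hh⟩)), zero_div]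
          simp [this]
      · intro h0
        have := congrFun h0 j1
        simp only [Pi.zero_apply, sub_eq_zero] at this
        apply hj1
        conv_lhs => rw [this]
        simp
      · intro i hi
        simp only [sub_mul, Finset.sum_sub_distrib]
        rw [hek i (by omega), zero_sub, neg_eq_zero]
        apply τ.injective
        rw [map_zero, ← hek (i + 1) (by omega), map_sum]
        refine Finset.sum_congr rfl fun j _ => ?_
        rw [map_mul, RingEquiv.apply_symm_apply, pow_succ', RingAut.mul_apply]

/-- The Wronskian (Casoratian) criterion: the determinant `det (E_{i-1}(z_j))`
vanishes iff `z_1, …, z_n` are linearly dependent over the fixed field `K^τ`. -/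
theorem carlitzE_det_eq_zero_iff {K : Type*} [Field K] (τ : RingAut K) (ϑ : K)
    (hϑ : ∀ k : ℕ, 1 ≤ k → (τ ^ k) ϑ ≠ ϑ) (n : ℕ) (hn : 2 ≤ n) (z : Fin n → K) :
    Matrix.det (Matrix.of fun i j : Fin n => carlitzE τ ϑ (i : ℕ) (z j)) = 0 ↔
      ∃ c : Fin n → K, (∀ i, τ (c i) = c i) ∧ c ≠ 0 ∧ ∑ i, c i * z i = 0 := by
  rw [← Matrix.exists_mulVec_eq_zero_iff]
  constructor
  · rintro ⟨d, hd0, hd⟩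
    have h : ∀ i < n, ∑ j, d j * carlitzE τ ϑ i (z j) = 0 := by
      intro i hi
      have := congrFun hd ⟨i, hi⟩
      simpa [Matrix.mulVec, dotProduct, mul_comm] using this
    refine casorati_dep τ n z n Finset.univ d (by simp) (by simp) hd0 ?_
    intro i hi
    exact carlitzE_kill τ ϑ hϑ n z d h i 0 (by omega)
  · rintro ⟨c, hc, hc0, hs⟩
    refine ⟨c, hc0, ?_⟩
    funext i
    have := carlitzE_sum τ ϑ z c hc i
    rw [hs, carlitzE_zero] at this
    simpa [Matrix.mulVec, dotProduct, mul_comm] using this.symm
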